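/- Let L be a finite extension of the rational function field 𝔽_q(θ), let n ≥ 1, and let α_1,…,α_ℓ ∈ L. Suppose: (1) α_1,…,α_ℓ are linearly independent over 𝔽_q; (2) v(α_i) > 0 for all 1 ≤ i ≤ ℓ and every infinite place v of L; (3) v(α_i) ≥ 1 − q for all 1 ≤ i ≤ ℓ and every finite place v of L. Then the points P_i := (0,…,0,α_i) ∈ C^{⊗n}(L) (last coordinate α_i, other coordinates 0) are linearly independent over 𝔽_q[t]: if a_1·P_1 + ⋯ + a_ℓ·P_ℓ = 0 with a_i ∈ 𝔽_q[t], then all a_i = 0. -/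

import Mathlib

open Polynomial

/-- The `t`-action `φ` on the `n`-th tensor power of the Carlitz module:
`φ(x_1,…,x_n) = (θx_1+x_2, …, θx_{n−1}+x_n, θx_n + x_1^q)`. -/
def carlitzPhi {L : Type*} [Field L] (q n : ℕ) (θ : L) (x : Fin n → L) : Fin n → L :=
  fun i => θ * x i +
    if h : (i : ℕ) + 1 < n then x ⟨(i : ℕ) + 1, h⟩
    else (x ⟨0, Nat.lt_of_le_of_lt (Nat.zero_le _) i.isLt⟩) ^ q

/-- The vector `(0,…,0,α)` whose last coordinate is `α` and whose other coordinates vanish. -/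
def lastVec {L : Type*} [Field L] (n : ℕ) (α : L) : Fin n → L :=
  fun i => if (i : ℕ) = n - 1 then α else 0

/-- The action of `a ∈ 𝔽_q[t]` on `C^{⊗n}(L)`, namely `a(φ)` applied to `x`; the
coefficients of `a` act through the ring homomorphism `χ : Fq →+* L`. -/
def carlitzAct {Fq L : Type*} [Field Fq] [Field L] (q n : ℕ) (θ : L) (χ : Fq →+* L)
    (a : Polynomial Fq) (x : Fin n → L) : Fin n → L :=
  ∑ i ∈ Finset.range (a.natDegree + 1), χ (a.coeff i) • (carlitzPhi q n θ)^[i] x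

/-- An additive valuation on a field `K`: a map `v : K → ℤ ∪ {∞}` with `v x = ∞` iff `x = 0`,
`v(xy) = v x + v y` and `v(x+y) ≥ min (v x) (v y)`. -/
structure AddVal (K : Type*) [Field K] where
  v : K → WithTop ℤ
  eq_top_iff : ∀ x, v x = ⊤ ↔ x = 0
  map_mul : ∀ x y, v (x * y) = v x + v y
  add_le : ∀ x y, min (v x) (v y) ≤ v (x + y)

/-- `ord_v` of a polynomial: the minimum of `v` over its coefficients (`∞` for `0`). -/
noncomputable def ordv {K : Type*} [Field K] (w : AddVal K) (h : Polynomial K) : WithTop ℤ :=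
  (Finset.range (h.natDegree + 1)).inf fun i => w.v (h.coeff i)

/-- `ord_v` of a point of `C^{⊗n}`: the minimum of `v` over its coordinates. -/
noncomputable def ordPt {K : Type*} [Field K] {n : ℕ} (w : AddVal K) (P : Fin n → K) :
    WithTop ℤ :=
  Finset.univ.inf fun i => w.v (P i)

/-- A place of a finite extension `L` of the rational function field `𝔽_q(θ)`: an additive
valuation on `L` that vanishes on all nonzero constants from `𝔽_q` and attains the value `1`. -/
structure Place (Fq L : Type*) [Field Fq] [Field L] [Algebra (RatFunc Fq) L] extends
    AddVal L where
  const_zero : ∀ c : Fq, c ≠ 0 →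
    v (algebraMap (RatFunc Fq) L (algebraMap Fq (RatFunc Fq) c)) = 0
  exists_one : ∃ x : L, v x = 1

/-- The element `θ` of `L`, i.e. the image in `L` of the variable of `𝔽_q(θ)`. -/
noncomputable def thetaL (Fq L : Type*) [Field Fq] [Field L] [Algebra (RatFunc Fq) L] : L :=
  algebraMap (RatFunc Fq) L RatFunc.X

/-- The canonical ring homomorphism `𝔽_q → L`. -/
noncomputable def constMap (Fq L : Type*) [Field Fq] [Field L] [Algebra (RatFunc Fq) L] :
    Fq →+* L :=
  (algebraMap (RatFunc Fq) L).comp (algebraMap Fq (RatFunc Fq))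

section Helpers

open Algebra

theorem exists_val (F L : Type*) [Field F] [Field L] [Algebra F L] (y : L)
    (hy : Transcendental F y) [Algebra.EssFiniteType F L] (htr : Algebra.trdeg F L ≤ 1) :
    ∃ val : Valuation L (WithZero (Multiplicative ℤ)),
      (∀ c : F, c ≠ 0 → val (algebraMap F L c) = 1) ∧ val y < 1 := by
  let : Algebra F[X] L := (aeval (R := F) y).toAlgebra
  have hmap : ∀ g : F[X], algebraMap F[X] L g = aeval y g := fun g => rfl
  have : IsScalarTower F F[X] L := IsScalarTower.of_algebraMap_eq fun c => by simp [hmap]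
  have : FaithfulSMul F[X] L := by
    rw [faithfulSMul_iff_algebraMap_injective]
    exact transcendental_iff_injective.mp hy
  have halg : Algebra.IsAlgebraic F[X] L := by
    rw [← trdeg_eq_zero_iff]
    have h := lift_trdeg_add_eq F F[X] L
    rw [Polynomial.trdeg_of_isDomain] at h
    have h2 := Cardinal.lift_le.mpr htr
    rw [← h] at h2
    simp at h2
    by_contra hne
    have := Cardinal.one_le_iff_ne_zero.mpr hne
    have h3 : (1:Cardinal) + 1 ≤ 1 := (add_le_add le_rfl (by simpa using this)).trans h2
    norm_num at h3
  let := FractionRing.liftAlgebra F[X] L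
  let K := FractionRing F[X]
  have : Algebra.IsAlgebraic K L := (IsFractionRing.comap_isAlgebraic_iff (A := F[X])).mp halg
  have : Algebra.EssFiniteType F[X] L := Algebra.EssFiniteType.of_comp F F[X] L
  have : Algebra.EssFiniteType K L := Algebra.EssFiniteType.of_comp F[X] K L
  have : FiniteDimensional K L := by
    obtain ⟨s, hs⟩ := IntermediateField.fg_top K L
    have := IntermediateField.finiteDimensional_adjoin (K := K) (L := L) (S := (s : Set L)) (fun x _ => Algebra.IsIntegral.isIntegral x)
    rw [hs] at this
    exact IntermediateField.topEquiv.toLinearEquiv.finiteDimensional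
  let S := separableClosure K L
  have : IsScalarTower F[X] S L := IsScalarTower.of_algebraMap_eq fun x => by
    rw [IsScalarTower.algebraMap_apply F[X] K S, ← IsScalarTower.algebraMap_apply K S L,
      ← IsScalarTower.algebraMap_apply F[X] K L]
  obtain ⟨p, hp⟩ := ExpChar.exists K
  let B := integralClosure F[X] S
  have : IsDedekindDomain B := integralClosure.isDedekindDomain F[X] K S
  have : IsFractionRing B S := integralClosure.isFractionRing_of_finite_extension K S
  have : FaithfulSMul F[X] B := by
    rw [faithfulSMul_iff_algebraMap_injective]
    have h := FaithfulSMul.algebraMap_injective F[X] L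
    rw [IsScalarTower.algebraMap_eq F[X] S L, IsScalarTower.algebraMap_eq F[X] B S] at h
    rw [RingHom.coe_comp, RingHom.coe_comp] at h
    exact Function.Injective.of_comp (Function.Injective.of_comp h)
  let I : Ideal F[X] := Ideal.span {X}
  have : I.IsMaximal := PrincipalIdealRing.isMaximal_of_irreducible irreducible_X
  obtain ⟨P, hP, hPI⟩ := Ideal.exists_maximal_ideal_liesOver_of_isIntegral I (S := B)
  have hXP : algebraMap F[X] B X ∈ P := by
    have : X ∈ I := Ideal.mem_span_singleton_self X
    rw [hPI.over] at this
    exact this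
  have hPbot : P ≠ ⊥ := by
    rintro rfl
    simp at hXP
  let Pv : IsDedekindDomain.HeightOneSpectrum B := ⟨P, hP.isPrime, hPbot⟩
  let N := IsPurelyInseparable.exponent S L
  let fr := IsPurelyInseparable.iterateFrobenius S L p (n := N) le_rfl
  have hfr : ∀ g : F[X], fr (algebraMap F[X] L g) = algebraMap B S (algebraMap F[X] B g) ^ p ^ N := by
    intro g
    rw [IsScalarTower.algebraMap_apply F[X] S L, IsPurelyInseparable.iterateFrobenius_algebraMap,
      IsScalarTower.algebraMap_apply F[X] B S]
  have hpN : p ^ N ≠ 0 := (pow_pos (expChar_pos K p) N).ne'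
  refine ⟨(Pv.valuation S).comap fr, ?_, ?_⟩
  · intro c hc
    rw [Valuation.comap_apply, IsScalarTower.algebraMap_apply F F[X] L, hfr, map_pow]
    have : IsUnit (algebraMap F[X] B (algebraMap F F[X] c)) :=
      ((IsUnit.mk0 c hc).map _).map _
    rw [Pv.valuation_eq_one_iff_notMem.mpr, one_pow]
    intro hm
    exact hP.ne_top (Ideal.eq_top_of_isUnit_mem _ hm this)
  · have : y = algebraMap F[X] L X := by simp [hmap]
    rw [Valuation.comap_apply, this, hfr, map_pow]
    apply pow_lt_one' _ hpN
    exact (Pv.valuation_lt_one_iff_mem _).mpr hXP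

theorem exists_place_of_val {Fq L : Type*} [Field Fq] [Field L] [Algebra (RatFunc Fq) L]
    (y : L) (hy0 : y ≠ 0) (val : Valuation L (WithZero (Multiplicative ℤ)))
    (hc : ∀ c : Fq, c ≠ 0 → val (constMap Fq L c) = 1) (hy : val y < 1) :
    ∃ w : Place Fq L, 0 < w.v y := by
  classical
  let f : L → ℤ := fun x => - WithZero.log (val x)
  have hne : ∀ {x : L}, x ≠ 0 → val x ≠ 0 := fun {x} hx => (Valuation.ne_zero_iff val).mpr hx
  have fmul : ∀ {x z : L}, x ≠ 0 → z ≠ 0 → f (x * z) = f x + f z := by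
    intro x z hx hz
    simp only [f, map_mul, WithZero.log_mul (hne hx) (hne hz)]
    ring
  have f1 : f 1 = 0 := by simp [f]
  have finv : ∀ x : L, f x⁻¹ = - f x := by
    intro x
    simp [f, WithZero.log_inv]
  have fadd : ∀ {x z : L}, x ≠ 0 → z ≠ 0 → x + z ≠ 0 → min (f x) (f z) ≤ f (x + z) := by
    intro x z hx hz hxz
    rcases le_max_iff.mp (val.map_add x z) with h | h
    · exact min_le_of_left_le (neg_le_neg ((WithZero.log_le_log (hne hxz) (hne hx)).mpr h))
    · exact min_le_of_right_le (neg_le_neg ((WithZero.log_le_log (hne hxz) (hne hz)).mpr h))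
  have fy : 0 < f y := by
    have := (WithZero.log_lt_log (hne hy0) one_ne_zero).mpr hy
    simp only [WithZero.log_one] at this
    simp only [f]
    omega
  let H : AddSubgroup ℤ :=
    { carrier := {z | ∃ x : L, x ≠ 0 ∧ f x = z}
      zero_mem' := ⟨1, one_ne_zero, f1⟩
      add_mem' := by
        rintro _ _ ⟨x, hx, rfl⟩ ⟨z, hz, rfl⟩
        exact ⟨x * z, mul_ne_zero hx hz, fmul hx hz⟩
      neg_mem' := by
        rintro _ ⟨x, hx, rfl⟩
        exact ⟨x⁻¹, inv_ne_zero hx, finv x⟩ }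
  obtain ⟨m0, hm0⟩ := Int.subgroup_cyclic H
  have hdvd : ∀ x : L, x ≠ 0 → m0 ∣ f x := by
    intro x hx
    have : f x ∈ H := ⟨x, hx, rfl⟩
    rw [hm0, AddSubgroup.mem_closure_singleton] at this
    obtain ⟨k, hk⟩ := this
    exact ⟨k, by rw [← hk, smul_eq_mul, mul_comm]⟩
  have hm0H : m0 ∈ H := by rw [hm0]; exact AddSubgroup.mem_closure_singleton_self m0
  obtain ⟨m, hm, hmH, hmd⟩ : ∃ m : ℤ, 0 < m ∧ m ∈ H ∧ ∀ x : L, x ≠ 0 → m ∣ f x := by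
    have h0 : m0 ≠ 0 := by
      rintro rfl
      have := hdvd y hy0
      rw [zero_dvd_iff] at this
      omega
    rcases lt_or_gt_of_ne h0 with h | h
    · exact ⟨-m0, by omega, neg_mem hm0H, fun x hx => (neg_dvd).mpr (hdvd x hx)⟩
    · exact ⟨m0, h, hm0H, hdvd⟩
  let w : Place Fq L :=
    { v := fun x => if x = 0 then ⊤ else ((f x / m : ℤ) : WithTop ℤ)
      eq_top_iff := by
        intro x
        by_cases hx : x = 0 <;> simp [hx]
      map_mul := by
        intro x z
        by_cases hx : x = 0
        · simp [hx]
        by_cases hz : z = 0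
        · simp [hz]
        simp only [hx, hz, mul_ne_zero hx hz, if_false]
        rw [fmul hx hz, Int.add_ediv_of_dvd_left (hmd x hx)]
        simp
      add_le := by
        intro x z
        by_cases hx : x = 0
        · simp [hx]
        by_cases hz : z = 0
        · simp [hz]
        by_cases hxz : x + z = 0
        · simp [hxz]
        simp only [hx, hz, hxz, if_false]
        rcases min_le_iff.mp (fadd hx hz hxz) with h | h
        · exact min_le_of_left_le (WithTop.coe_le_coe.mpr (Int.ediv_le_ediv hm h))
        · exact min_le_of_right_le (WithTop.coe_le_coe.mpr (Int.ediv_le_ediv hm h))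
      const_zero := by
        intro c hcc
        have h := hc c hcc
        have h0 : constMap Fq L c ≠ 0 := by
          intro h0
          rw [h0] at h
          simp at h
        change (if constMap Fq L c = 0 then (⊤ : WithTop ℤ) else ((f (constMap Fq L c) / m : ℤ) : WithTop ℤ)) = 0
        rw [if_neg h0]
        simp [f, h]
      exists_one := by
        obtain ⟨x, hx, hxm⟩ := hmH
        refine ⟨x, ?_⟩
        simp only [hx, if_false, hxm]
        rw [Int.ediv_self hm.ne']
        rfl }
  refine ⟨w, ?_⟩
  change 0 < (if y = 0 then (⊤ : WithTop ℤ) else ((f y / m : ℤ) : WithTop ℤ))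
  rw [if_neg hy0]
  have : 0 < f y / m := Int.ediv_pos_of_pos_of_dvd fy hm.le (hmd y hy0)
  exact_mod_cast this

theorem exists_place {Fq L : Type*} [Field Fq] [Field L] [Algebra (RatFunc Fq) L]
    [FiniteDimensional (RatFunc Fq) L] [Algebra Fq L] [IsScalarTower Fq (RatFunc Fq) L]
    (y : L) (hy : Transcendental Fq y) : ∃ w : Place Fq L, 0 < w.v y := by
  have : EssFiniteType Fq[X] (RatFunc Fq) := EssFiniteType.of_isLocalization _ (nonZeroDivisors Fq[X])
  have : EssFiniteType Fq (RatFunc Fq) := EssFiniteType.comp Fq Fq[X] (RatFunc Fq)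
  have : EssFiniteType Fq L := EssFiniteType.comp Fq (RatFunc Fq) L
  have htr : trdeg Fq L ≤ 1 := by
    have h1 := trdeg_add_eq Fq Fq[X] (A := RatFunc Fq)
    have : Algebra.IsAlgebraic Fq[X] (RatFunc Fq) := IsLocalization.isAlgebraic _ (nonZeroDivisors Fq[X])
    rw [Polynomial.trdeg_of_isDomain, trdeg_eq_zero] at h1
    have h2 := lift_trdeg_add_eq Fq (RatFunc Fq) L
    rw [trdeg_eq_zero (R := RatFunc Fq), ← h1] at h2
    simp at h2
    exact h2.symm.le
  obtain ⟨val, h1, h2⟩ := exists_val Fq L y hy htr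
  refine exists_place_of_val y (fun h => hy (h ▸ isAlgebraic_zero)) val (fun c hc => ?_) h2
  have := h1 c hc
  rwa [IsScalarTower.algebraMap_apply Fq (RatFunc Fq) L] at this

theorem AddVal.v_one {K : Type*} [Field K] (w : AddVal K) : w.v 1 = 0 := by
  have h := w.map_mul 1 1
  rw [mul_one] at h
  have h1 : w.v 1 ≠ ⊤ := fun h => one_ne_zero ((w.eq_top_iff 1).mp h)
  lift w.v 1 to ℤ using h1 with z
  norm_cast at *
  omega

/-- The Mathlib additive valuation of an `AddVal`. -/
noncomputable def AddVal.toV {K : Type*} [Field K] (w : AddVal K) : AddValuation K (WithTop ℤ) :=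
  AddValuation.of w.v ((w.eq_top_iff 0).mpr rfl) w.v_one w.add_le w.map_mul

theorem AddVal.toV_apply {K : Type*} [Field K] (w : AddVal K) (x : K) : w.toV x = w.v x := rfl

theorem eq_zero_of_places {Fq L : Type*} [Field Fq] [Finite Fq] [Field L] [Algebra (RatFunc Fq) L]
    [FiniteDimensional (RatFunc Fq) L] (x : L)
    (hfin : ∀ w : Place Fq L, 0 ≤ w.v (thetaL Fq L) → 0 ≤ w.v x)
    (hinf : ∀ w : Place Fq L, w.v (thetaL Fq L) < 0 → 0 < w.v x) : x = 0 := by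
  by_contra hx
  let : Algebra Fq L := (constMap Fq L).toAlgebra
  have : IsScalarTower Fq (RatFunc Fq) L := IsScalarTower.of_algebraMap_eq fun c => rfl
  by_cases halg : IsAlgebraic Fq x
  · have htr : Transcendental Fq (thetaL Fq L)⁻¹ := by
      intro h
      have h2 : IsAlgebraic Fq (thetaL Fq L) := by simpa using h.inv
      have h3 : IsAlgebraic Fq (RatFunc.X : RatFunc Fq) :=
        (isAlgebraic_algebraMap_iff (algebraMap (RatFunc Fq) L).injective).mp h2
      exact RatFunc.transcendental_X h3
    obtain ⟨w, hw⟩ := exists_place _ htr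
    have hth : thetaL Fq L ≠ 0 := by
      intro h
      rw [h, inv_zero] at htr
      exact htr isAlgebraic_zero
    have h1 : w.v (thetaL Fq L) < 0 := by
      have h := w.map_mul (thetaL Fq L) (thetaL Fq L)⁻¹
      rw [mul_inv_cancel₀ hth, w.v_one] at h
      by_contra h2
      push Not at h2
      exact absurd h (lt_of_lt_of_le hw (le_add_of_nonneg_left h2)).ne
    have h2 := hinf w h1
    have : FiniteDimensional Fq (IntermediateField.adjoin Fq {x}) :=
      IntermediateField.adjoin.finiteDimensional halg.isIntegral
    have : Finite (IntermediateField.adjoin Fq {x}) := Module.finite_of_finite Fq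
    let x' : IntermediateField.adjoin Fq {x} := ⟨x, IntermediateField.mem_adjoin_simple_self Fq x⟩
    have hx' : x' ≠ 0 := fun h => hx (congrArg Subtype.val h)
    obtain ⟨k, hk, hk1⟩ := (isOfFinOrder_of_finite (Units.mk0 x' hx')).exists_pow_eq_one
    have hk2 : x ^ k = 1 := congrArg (fun u : (IntermediateField.adjoin Fq {x})ˣ => ((u : IntermediateField.adjoin Fq {x}) : L)) hk1
    have h3 := w.toV.map_pow x k
    rw [hk2, AddVal.toV_apply, AddVal.toV_apply, w.v_one] at h3
    exact absurd h3 (nsmul_pos h2 hk.ne').ne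
  · have htr : Transcendental Fq x⁻¹ := fun h => halg (by simpa using h.inv)
    obtain ⟨w, hw⟩ := exists_place _ htr
    have h0 : 0 ≤ w.v x := by
      rcases lt_or_ge (w.v (thetaL Fq L)) 0 with h | h
      · exact (hinf w h).le
      · exact hfin w h
    have h := w.map_mul x x⁻¹
    rw [mul_inv_cancel₀ hx, w.v_one] at h
    exact absurd h (lt_of_lt_of_le hw (le_add_of_nonneg_left h0)).ne

/-- The polynomial attached to a point of `C^{⊗n}(L)`. -/
noncomputable def psiPoly {L : Type*} [Field L] {n : ℕ} (θ : L) (x : Fin n → L) : L[X] :=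
  ∑ i : Fin n, C (x i) * (X - C θ) ^ (n - 1 - (i : ℕ))

theorem psiPoly_step {L : Type*} [Field L] (q n : ℕ) (hn : 1 ≤ n) (θ : L) (x : Fin n → L) :
    X * psiPoly θ x - psiPoly θ (carlitzPhi q n θ x) =
      (X - C θ) ^ n * C (x ⟨0, hn⟩) - C (x ⟨0, hn⟩ ^ q) := by
  obtain ⟨m, rfl⟩ : ∃ m, n = m + 1 := ⟨n - 1, by omega⟩
  have h1 : psiPoly θ (carlitzPhi q (m + 1) θ x) = C θ * psiPoly θ x +
      ((∑ j : Fin m, C (x j.succ) * (X - C θ) ^ (m - (j : ℕ))) + C (x ⟨0, hn⟩ ^ q)) := by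
    have h2 : (∑ j : Fin m, C (x j.succ) * (X - C θ) ^ (m - (j : ℕ))) + C (x ⟨0, hn⟩ ^ q) =
      ∑ i : Fin (m + 1), C (if h : (i : ℕ) + 1 < m + 1 then x ⟨(i : ℕ) + 1, h⟩
        else (x ⟨0, Nat.lt_of_le_of_lt (Nat.zero_le _) i.isLt⟩) ^ q) *
          (X - C θ) ^ (m + 1 - 1 - (i : ℕ)) := by
      rw [Fin.sum_univ_castSucc]
      congr 1
      · refine Finset.sum_congr rfl fun j _ => ?_
        have : ((j.castSucc : Fin (m + 1)) : ℕ) + 1 < m + 1 := by simp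
        rw [dif_pos this]
        rfl
      · simp
    rw [h2, psiPoly, psiPoly, Finset.mul_sum, ← Finset.sum_add_distrib]
    refine Finset.sum_congr rfl fun i _ => ?_
    rw [carlitzPhi, C_add, C_mul]
    ring
  have h3 : (X - C θ) * psiPoly θ x = (X - C θ) ^ (m + 1) * C (x ⟨0, hn⟩) +
      ∑ j : Fin m, C (x j.succ) * (X - C θ) ^ (m - (j : ℕ)) := by
    rw [psiPoly, Fin.sum_univ_succ, mul_add, Finset.mul_sum]
    congr 1
    · simp only [Fin.val_zero, Nat.sub_zero, Nat.add_sub_cancel]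
      change (X - C θ) * (C (x ⟨0, hn⟩) * _) = _
      ring
    · refine Finset.sum_congr rfl fun j _ => ?_
      have : m - (j : ℕ) = (m + 1 - 1 - ((j.succ : Fin (m + 1)) : ℕ)) + 1 := by
        have := j.isLt
        simp only [Fin.val_succ]
        omega
      rw [this]
      ring
  rw [h1]
  linear_combination h3

/-- The map `g ↦ (t-θ)^n g - g^{(1)}`. -/
noncomputable def relMap {L : Type*} [Field L] (n : ℕ) (θ : L) (fr : L →+* L) : L[X] →+ L[X] where
  toFun g := (X - C θ) ^ n * g - g.map fr
  map_zero' := by simp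
  map_add' a b := by
    rw [Polynomial.map_add]
    ring

theorem relMap_mul {Fq L : Type*} [Field Fq] [Field L] (n : ℕ) (θ : L) (fr : L →+* L)
    (χ : Fq →+* L) (hχ : fr.comp χ = χ) (a : Fq[X]) (h : L[X]) (hh : h ∈ (relMap n θ fr).range) :
    a.map χ * h ∈ (relMap n θ fr).range := by
  obtain ⟨g, rfl⟩ := hh
  refine ⟨a.map χ * g, ?_⟩
  change (X - C θ) ^ n * (a.map χ * g) - (a.map χ * g).map fr =
    a.map χ * ((X - C θ) ^ n * g - g.map fr)
  rw [Polynomial.map_mul, Polynomial.map_map, hχ]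
  ring

theorem psiPoly_iter {Fq L : Type*} [Field Fq] [Field L] (q n : ℕ) (hn : 1 ≤ n) (θ : L)
    (fr : L →+* L) (hfr : ∀ x, fr x = x ^ q)
    (χ : Fq →+* L) (hχ : fr.comp χ = χ) (x : Fin n → L) (k : ℕ) :
    X ^ k * psiPoly θ x - psiPoly θ ((carlitzPhi q n θ)^[k] x) ∈ (relMap n θ fr).range := by
  induction k with
  | zero => simp
  | succ k ih =>
    rw [Function.iterate_succ_apply']
    set z := (carlitzPhi q n θ)^[k] x
    have h1 := relMap_mul n θ fr χ hχ X _ ih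
    have h2 : X * psiPoly θ z - psiPoly θ (carlitzPhi q n θ z) ∈ (relMap n θ fr).range := by
      rw [psiPoly_step q n hn]
      refine ⟨C (z ⟨0, hn⟩), ?_⟩
      change (X - C θ) ^ n * C (z ⟨0, hn⟩) - (C (z ⟨0, hn⟩)).map fr = _
      rw [map_C, hfr]
    have h3 := add_mem h1 h2
    rw [Polynomial.map_X] at h3
    convert h3 using 1
    ring

/-- `psiPoly` as a linear map. -/
noncomputable def psiLin {L : Type*} [Field L] (n : ℕ) (θ : L) : (Fin n → L) →ₗ[L] L[X] where
  toFun x := psiPoly θ x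
  map_add' x y := by
    simp only [psiPoly, Pi.add_apply, C_add, add_mul, Finset.sum_add_distrib]
  map_smul' c x := by
    simp only [psiPoly, Pi.smul_apply, smul_eq_mul, C_mul, RingHom.id_apply, smul_eq_C_mul,
      Finset.mul_sum, mul_assoc]

theorem psiPoly_act {Fq L : Type*} [Field Fq] [Field L] (q n : ℕ) (hn : 1 ≤ n) (θ : L)
    (fr : L →+* L) (hfr : ∀ x, fr x = x ^ q)
    (χ : Fq →+* L) (hχ : fr.comp χ = χ) (x : Fin n → L) (a : Fq[X]) :
    a.map χ * psiPoly θ x - psiLin n θ (carlitzAct q n θ χ a x) ∈ (relMap n θ fr).range := by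
  have h1 : a.map χ = ∑ k ∈ Finset.range (a.natDegree + 1), (C (a.coeff k)).map χ * X ^ k := by
    conv_lhs => rw [a.as_sum_range_C_mul_X_pow]
    simp [Polynomial.map_sum]
  rw [carlitzAct, map_sum, h1, Finset.sum_mul, ← Finset.sum_sub_distrib]
  refine sum_mem fun k _ => ?_
  have := relMap_mul n θ fr χ hχ (C (a.coeff k)) _ (psiPoly_iter q n hn θ fr hfr χ hχ x k)
  convert this using 1
  rw [map_smul, smul_eq_C_mul, mul_sub, mul_assoc, Polynomial.map_C]
  rfl

theorem psiPoly_lastVec {L : Type*} [Field L] (n : ℕ) (hn : 1 ≤ n) (θ α : L) :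
    psiPoly θ (lastVec n α) = C α := by
  rw [psiPoly, Finset.sum_eq_single ⟨n - 1, by omega⟩]
  · simp [lastVec]
  · intro i _ hi
    have : (i : ℕ) ≠ n - 1 := fun h => hi (Fin.ext h)
    simp [lastVec, this]
  · simp

theorem coeff_bound {K : Type*} [Field K] (w : AddVal K) (θ : K) (hθ : 0 ≤ w.v θ) (m : WithTop ℤ)
    (g : K[X]) (hg : ∀ j, m ≤ w.v (g.coeff j)) (n : ℕ) :
    ∀ j, m ≤ w.v (((X - C θ) ^ n * g).coeff j) := by
  induction n with
  | zero => simpa using hg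
  | succ n ih =>
    intro j
    rw [pow_succ', mul_assoc, sub_mul, coeff_sub, coeff_C_mul]
    have h1 : m ≤ w.v ((X * ((X - C θ) ^ n * g)).coeff j) := by
      cases j with
      | zero =>
        rw [coeff_X_mul_zero, (w.eq_top_iff 0).mpr rfl]
        exact le_top
      | succ j =>
        rw [coeff_X_mul]
        exact ih j
    have h2 : m ≤ w.v (θ * ((X - C θ) ^ n * g).coeff j) := by
      rw [w.map_mul]
      exact (ih j).trans (le_add_of_nonneg_left hθ)
    exact (le_min h1 h2).trans (w.toV.map_sub _ _)

theorem coeff_nonneg {K : Type*} [Field K] (w : AddVal K) (θ : K) (hθ : 0 ≤ w.v θ) (q n : ℕ)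
    (hq : 2 ≤ q) (fr : K →+* K) (hfr : ∀ x, fr x = x ^ q) (g : K[X])
    (hf : ∀ j, ((1 - (q : ℤ) : ℤ) : WithTop ℤ) ≤ w.v ((relMap n θ fr g).coeff j)) (j : ℕ) :
    0 ≤ w.v (g.coeff j) := by
  obtain ⟨i, -, hi⟩ := Finset.exists_min_image (Finset.range (g.natDegree + 1))
    (fun i => w.v (g.coeff i)) ⟨0, by simp⟩
  have hmin : ∀ j, w.v (g.coeff i) ≤ w.v (g.coeff j) := by
    intro j
    by_cases hj : j < g.natDegree + 1
    · exact hi j (Finset.mem_range.mpr hj)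
    · rw [coeff_eq_zero_of_natDegree_lt (by omega : g.natDegree < j), (w.eq_top_iff 0).mpr rfl]
      exact le_top
  refine le_trans ?_ (hmin j)
  by_contra hneg
  push Not at hneg
  have h1 := coeff_bound w θ hθ _ g hmin n i
  have h2 := hf i
  have h3 : (g.coeff i) ^ q = ((X - C θ) ^ n * g).coeff i - (relMap n θ fr g).coeff i := by
    change _ = ((X - C θ) ^ n * g).coeff i - ((X - C θ) ^ n * g - g.map fr).coeff i
    rw [coeff_sub, coeff_map, hfr]
    ring
  have h4 := w.toV.map_sub (((X - C θ) ^ n * g).coeff i) ((relMap n θ fr g).coeff i)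
  rw [← h3, AddValuation.map_pow] at h4
  simp only [AddVal.toV_apply] at h4
  have h5 := (min_le_min h1 h2).trans h4
  have hnt : w.v (g.coeff i) ≠ ⊤ := ne_top_of_lt hneg
  generalize w.v (g.coeff i) = z at *
  lift z to ℤ using hnt
  have hz : z < 0 := by exact_mod_cast hneg
  have h6 : min z (1 - (q : ℤ)) ≤ q * z := by
    have : (q • (z : WithTop ℤ)) = ((q * z : ℤ) : WithTop ℤ) := by
      rw [← WithTop.coe_nsmul, nsmul_eq_mul]
    rw [this] at h5
    exact_mod_cast h5
  have hq' : (2 : ℤ) ≤ q := by exact_mod_cast hq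
  rcases min_le_iff.mp h6 with h | h <;> nlinarith

end Helpers

/-- Sufficient conditions on `α_1,…,α_ℓ ∈ L` for the points `(0,…,0,α_i) ∈ C^{⊗n}(L)`
to be linearly independent over `𝔽_q[t]`. -/
theorem carlitz_last_coordinate_points_independent
    (p q e : ℕ) (hp : p.Prime) (he : 0 < e) (hq : q = p ^ e)
    (Fq : Type*) [Field Fq] [Fintype Fq] (hFq : Fintype.card Fq = q)
    (L : Type*) [Field L] [Algebra (RatFunc Fq) L] [FiniteDimensional (RatFunc Fq) L]
    (n : ℕ) (hn : 1 ≤ n) (ℓ : ℕ) (α : Fin ℓ → L)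
    (hindep : ∀ c : Fin ℓ → Fq, ∑ i : Fin ℓ, constMap Fq L (c i) * α i = 0 → ∀ i, c i = 0)
    (hinf : ∀ w : Place Fq L, w.v (thetaL Fq L) < 0 → ∀ i, 0 < w.v (α i))
    (hfin : ∀ w : Place Fq L, 0 ≤ w.v (thetaL Fq L) →
      ∀ i, ((1 - (q : ℤ) : ℤ) : WithTop ℤ) ≤ w.v (α i))
    (a : Fin ℓ → Polynomial Fq)
    (ha : ∑ i : Fin ℓ, carlitzAct q n (thetaL Fq L) (constMap Fq L) (a i)
        (lastVec n (α i)) = 0) :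
    ∀ i, a i = 0 := by
  obtain ⟨hq2⟩ : Nonempty (2 ≤ q) := ⟨by
    rw [← hFq]
    exact Fintype.one_lt_card⟩
  set θ := thetaL Fq L
  set χ := constMap Fq L with hχdef
  let : Algebra Fq L := χ.toAlgebra
  let fr : L →+* L := (FiniteField.frobeniusAlgHom Fq L : L →ₐ[Fq] L)
  have hfr : ∀ x, fr x = x ^ q := fun x => by
    rw [← hFq]
    rfl
  have hχ : fr.comp χ = χ := by
    ext c
    rw [RingHom.comp_apply, hfr, ← map_pow, ← hFq, FiniteField.pow_card]
  set f : L[X] := ∑ i, (a i).map χ * C (α i) with hf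
  have hfmem : f ∈ (relMap n θ fr).range := by
    have h0 := sum_mem (t := Finset.univ) fun (i : Fin ℓ) _ =>
      psiPoly_act q n hn θ fr hfr χ hχ (lastVec n (α i)) (a i)
    rw [Finset.sum_sub_distrib, ← map_sum, ha, map_zero, sub_zero] at h0
    simpa only [psiPoly_lastVec n hn] using h0
  have hcoeff : ∀ j, f.coeff j = ∑ i, χ ((a i).coeff j) * α i := by
    intro j
    simp [hf]
  have hχv : ∀ (w : Place Fq L) (c : Fq), 0 ≤ w.v (χ c) := by
    intro w c
    by_cases hc : c = 0
    · rw [hc, map_zero, (w.eq_top_iff 0).mpr rfl]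
      exact le_top
    · exact (w.const_zero c hc).ge
  have hffin : ∀ w : Place Fq L, 0 ≤ w.v θ → ∀ j,
      ((1 - (q : ℤ) : ℤ) : WithTop ℤ) ≤ w.v (f.coeff j) := by
    intro w hw j
    rw [hcoeff]
    refine w.toV.map_le_sum fun i _ => ?_
    rw [AddVal.toV_apply, w.map_mul]
    exact (hfin w hw i).trans (le_add_of_nonneg_left (hχv w _))
  have hfinf : ∀ w : Place Fq L, w.v θ < 0 → ∀ j, 0 < w.v (f.coeff j) := by
    intro w hw j
    rw [hcoeff]
    refine w.toV.map_lt_sum (by simp) fun i _ => ?_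
    rw [AddVal.toV_apply, w.map_mul]
    exact lt_of_lt_of_le (hinf w hw i) (le_add_of_nonneg_left (hχv w _))
  obtain ⟨g, hg⟩ := hfmem
  have hgf : g.leadingCoeff = f.coeff (n + g.natDegree) := by
    have hmon : ((X - C θ) ^ n).Monic := (monic_X_sub_C θ).pow n
    have hdeg : ((X - C θ) ^ n).natDegree = n := by simp
    rw [← hg]
    change _ = ((X - C θ) ^ n * g - g.map fr).coeff _
    rw [coeff_sub, coeff_map, coeff_eq_zero_of_natDegree_lt (by omega : g.natDegree < n + g.natDegree),
      map_zero, sub_zero]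
    have h7 := coeff_mul_degree_add_degree ((X - C θ) ^ n) g
    rw [hdeg, hmon.leadingCoeff, one_mul] at h7
    exact h7.symm
  have hlead : g.leadingCoeff = 0 := by
    refine eq_zero_of_places (Fq := Fq) _ (fun w hw => ?_) (fun w hw => ?_)
    · refine coeff_nonneg w.toAddVal θ hw q n hq2 fr hfr g ?_ _
      rw [hg]
      exact hffin w hw
    · rw [hgf]
      exact hfinf w hw _
  have hg0 : g = 0 := leadingCoeff_eq_zero.mp hlead
  have hf0 : f = 0 := by rw [← hg, hg0, map_zero]
  intro i
  ext j
  have := hcoeff j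
  rw [hf0, coeff_zero] at this
  simpa using hindep (fun i => (a i).coeff j) this.symm i
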